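/- arXiv:2604.08311 — 7 statements merged into one kernel-verified Lean document; each statement's English description precedes it below -/
import Mathlib

section
/- Let n = 2m with 0 < i < m, and let F : F_{2^n} → F_{2^n} be given by F(x) = x^{1+2^i} + x^{1+2^{m+i}}. Then F has the maximal number of bent components, i.e. #S_F = 2^m. -/
open Finset

/-- The Walsh transform `W_{F_a}(ω) = Σ_v (−1)^{Tr(a·F(v)) + Tr(ω·v)}` of the component
function `F_a` of a vectorial function `F` over a finite field `K` of characteristic 2. -/
noncomputable def walsh {K : Type*} [Field K] [Fintype K] [Algebra (ZMod 2) K]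
    (F : K → K) (a ω : K) : ℤ :=
  ∑ v : K, if Algebra.trace (ZMod 2) K (a * F v) + Algebra.trace (ZMod 2) K (ω * v) = 0
    then 1 else -1

/-- The component `F_a` is bent: all Walsh values are `±2^m` (where the field has `2^(2m)`
elements). -/
def IsBent {K : Type*} [Field K] [Fintype K] [Algebra (ZMod 2) K]
    (m : ℕ) (F : K → K) (a : K) : Prop :=
  ∀ ω : K, walsh F a ω = 2 ^ m ∨ walsh F a ω = -(2 ^ m)

/-- The sign `(−1)^t` of a bit. -/
def bitSign (t : ZMod 2) : ℤ := if t = 0 then 1 else -1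

lemma bitSign_add (s t : ZMod 2) : bitSign (s + t) = bitSign s * bitSign t := by
  revert s t; decide

lemma bitSign_eq_neg_one {t : ZMod 2} (h : t ≠ 0) : bitSign t = -1 := if_neg h

lemma sum_bitSign_eq_zero {G : Type*} [AddCommGroup G] [Fintype G] (f : G → ZMod 2) (u : G)
    (h : ∀ v, f (v + u) = f v + 1) : ∑ v, bitSign (f v) = 0 := by
  have key : ∑ v, bitSign (f v) = ∑ v, -bitSign (f v) := by
    rw [← Equiv.sum_comp (Equiv.addRight u)]
    refine sum_congr rfl fun v _ => ?_
    rw [Equiv.coe_addRight, h, bitSign_add, bitSign_eq_neg_one one_ne_zero, mul_neg_one]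
  rw [sum_neg_distrib] at key
  linarith

section Field

variable {K : Type*} [Field K] [Fintype K] [Algebra (ZMod 2) K]

local notation "Tr" => Algebra.trace (ZMod 2) K

lemma trace_nondegenerate_two {c : K} (h : ∀ w, Tr (c * w) = 0) : c = 0 := by
  have : Module.Finite (ZMod 2) K := Module.Finite.of_finite
  exact (traceForm_nondegenerate (ZMod 2) K).1 c h

lemma trace_pow_two_pow (k : ℕ) (x : K) : Tr (x ^ 2 ^ k) = Tr x := by
  induction k with
  | zero => simp
  | succ k ih =>
    rw [pow_succ, pow_mul, ← ih]
    have : Module.Finite (ZMod 2) K := Module.Finite.of_finite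
    have h := Algebra.trace_eq_of_algEquiv
      (FiniteField.frobeniusAlgEquivOfAlgebraic (ZMod 2) K) (x ^ 2 ^ k)
    simpa [FiniteField.coe_frobeniusAlgEquivOfAlgebraic] using h

lemma walsh_eq_sum_bitSign (F : K → K) (a ω : K) :
    walsh F a ω = ∑ v : K, bitSign (Tr (a * F v + ω * v)) := by
  simp [walsh, bitSign]

lemma charP_two_of_algebra (K : Type*) [Field K] [Algebra (ZMod 2) K] : CharP K 2 :=
  charP_of_injective_algebraMap (algebraMap (ZMod 2) K).injective 2

/-- A component with a nonzero invariant shift is not bent. -/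
lemma not_isBent_of_invariant (m : ℕ) (F : K → K) (a u : K) (hu : u ≠ 0)
    (h : ∀ v, Tr (a * F (v + u)) = Tr (a * F v)) : ¬ IsBent m F a := by
  intro hb
  obtain ⟨ω, hω⟩ : ∃ ω, Tr (ω * u) ≠ 0 := by
    by_contra! hc
    exact hu (trace_nondegenerate_two fun w => by rw [mul_comm]; exact hc w)
  have h1 : Tr (ω * u) = 1 := by
    generalize Tr (ω * u) = t at hω
    revert t; decide
  have h0 : walsh F a ω = 0 := by
    rw [walsh_eq_sum_bitSign]
    refine sum_bitSign_eq_zero _ u fun v => ?_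
    rw [map_add, map_add, h, mul_add, map_add, h1, add_assoc]
  have hp : (2 : ℤ) ^ m ≠ 0 := by positivity
  rcases hb ω with h2 | h2 <;> rw [h0] at h2
  · exact hp h2.symm
  · exact hp (by linarith)

/-- If every derivative of `F_a` in a nonzero direction is a nonconstant affine function, then
`F_a` is bent. -/
lemma isBent_of_derivative_nonconstant (m : ℕ) (hcard : Fintype.card K = 2 ^ (2 * m))
    (F : K → K) (a : K) (B : K → K →+ ZMod 2)
    (hB : ∀ u v, Tr (a * F (v + u)) = Tr (a * F v) + Tr (a * F u) + B u v)
    (hnd : ∀ u, (∀ v, B u v = 0) → u = 0) : IsBent m F a := by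
  intro ω
  have hB0 : ∀ v, Tr (a * F 0) + B 0 v = 0 := fun v => by
    have := hB 0 v
    rw [add_zero, add_assoc] at this
    simpa using this
  have hF0 : Tr (a * F 0) = 0 := by simpa using hB0 0
  have hinner : ∀ u, u ≠ 0 → ∑ v, bitSign (B u v) = 0 := fun u hu => by
    obtain ⟨w, hw⟩ : ∃ w, B u w ≠ 0 := by
      by_contra! hc
      exact hu (hnd u hc)
    have h1 : B u w = 1 := by
      generalize B u w = t at hw
      revert t; decide
    exact sum_bitSign_eq_zero _ w fun v => by rw [map_add, h1]
  have hsq : walsh F a ω ^ 2 = (2 ^ m) ^ 2 := by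
    calc walsh F a ω ^ 2
        = ∑ v, ∑ u, bitSign (Tr (a * F v + ω * v)) * bitSign (Tr (a * F u + ω * u)) := by
          rw [sq, walsh_eq_sum_bitSign, sum_mul_sum]
      _ = ∑ v, ∑ u, bitSign (Tr (a * F u + ω * u)) * bitSign (B u v) := by
          refine sum_congr rfl fun v _ => ?_
          rw [← Equiv.sum_comp (Equiv.addLeft v)]
          refine sum_congr rfl fun u _ => ?_
          rw [Equiv.coe_addLeft, ← bitSign_add, ← bitSign_add]
          congr 1
          simp only [map_add, hB, mul_add]
          generalize Tr (a * F v) = p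
          generalize Tr (a * F u) = q
          generalize Tr (ω * v) = r
          generalize Tr (ω * u) = s
          generalize B u v = t
          revert p q r s t; decide
      _ = ∑ u, bitSign (Tr (a * F u + ω * u)) * ∑ v, bitSign (B u v) := by
          rw [sum_comm]
          simp only [mul_sum]
      _ = (2 ^ m) ^ 2 := by
          rw [sum_eq_single 0 (fun u _ hu => by rw [hinner u hu, mul_zero]) (by simp)]
          have hz : ∀ v, B 0 v = 0 := fun v => by simpa [hF0] using hB0 v
          simp only [hz, hF0, mul_zero, add_zero]
          simp [bitSign, hcard, ← pow_mul, mul_comm]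
  exact sq_eq_sq_iff_eq_or_eq_neg.mp hsq

/-- In a field with `q²` elements, `q = 2^m`, exactly `q` elements are fixed by `x ↦ x^q`. -/
lemma ncard_fixed_pow (m : ℕ) (hm : 0 < m) (hcard : Fintype.card K = 2 ^ (2 * m)) :
    Set.ncard {a : K | a ^ 2 ^ m = a} = 2 ^ m := by
  classical
  have := charP_two_of_algebra K
  have hq : 1 < 2 ^ m := Nat.one_lt_two_pow hm.ne'
  apply le_antisymm
  · have hne : (Polynomial.X ^ 2 ^ m - Polynomial.X : Polynomial K) ≠ 0 :=
      FiniteField.X_pow_card_sub_X_ne_zero K hq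
    have hsub : {a : K | a ^ 2 ^ m = a} ⊆
        ((Polynomial.X ^ 2 ^ m - Polynomial.X : Polynomial K).roots.toFinset : Set K) := by
      intro a ha
      simpa [hne, sub_eq_zero] using ha
    refine (Set.ncard_le_ncard hsub (Finset.finite_toSet _)).trans ?_
    rw [Set.ncard_coe_finset]
    refine (Multiset.toFinset_card_le _).trans ((Polynomial.card_roots' _).trans ?_)
    rw [FiniteField.X_pow_card_sub_X_natDegree_eq K hq]
  · let T : K →+ K := (iterateFrobenius K 2 m : K →+ K) + AddMonoidHom.id K
    have hT : ∀ x, T x = x ^ 2 ^ m + x := fun x => rfl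
    have hker : (T.ker : Set K) = {a : K | a ^ 2 ^ m = a} := by
      ext a
      simp [AddMonoidHom.mem_ker, hT, CharTwo.add_eq_zero]
    have hrange : (T.range : Set K) ⊆ {a : K | a ^ 2 ^ m = a} := by
      rintro _ ⟨x, rfl⟩
      rw [Set.mem_ofPred_eq, hT, add_pow_char_pow, ← pow_mul, ← pow_add, ← two_mul, ← hcard,
        FiniteField.pow_card, add_comm]
    have hmul : Nat.card T.ker * Nat.card T.range = (2 ^ m) ^ 2 := by
      rw [← AddSubgroup.index_ker, AddSubgroup.card_mul_index, Nat.card_eq_fintype_card, hcard,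
        ← pow_mul, mul_comm]
    have h1 : Nat.card T.ker = Set.ncard {a : K | a ^ 2 ^ m = a} := by
      rw [← hker]; rfl
    have h2 : Nat.card T.range ≤ Set.ncard {a : K | a ^ 2 ^ m = a} :=
      Set.ncard_le_ncard hrange (Set.toFinite _)
    rw [h1] at hmul
    by_contra! hlt
    nlinarith

end Field

/-- If `n = 2m`, `0 < i < m`, then `F(x) = x^{1+2^i} + x^{1+2^{m+i}}` over `F_{2^n}` has the
maximal number of bent components, i.e. `#S_F = 2^m`. -/
theorem stmt0 (m n : ℕ) (hm : 0 < m) (hn : n = 2 * m)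
    (K : Type*) [Field K] [Fintype K] [Algebra (ZMod 2) K]
    (hcard : Fintype.card K = 2 ^ n)
    (i : ℕ) (hi1 : 0 < i) (hi2 : i < m)
    (F : K → K) (hF : ∀ x, F x = x ^ (1 + 2 ^ i) + x ^ (1 + 2 ^ (m + i))) :
    Set.ncard {a : K | ¬ IsBent m F a} = 2 ^ m := by
  subst hn
  have := charP_two_of_algebra K
  let T : K →+ K := AddMonoidHom.id K + (iterateFrobenius K 2 m : K →+ K)
  have hT : ∀ x, T x = x + x ^ 2 ^ m := fun x => rfl
  have hbar : ∀ x : K, (x ^ 2 ^ m) ^ 2 ^ m = x := fun x => by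
    rw [← pow_mul, ← pow_add, ← two_mul, ← hcard, FiniteField.pow_card]
  have hTfix : ∀ x, T x ^ 2 ^ m = T x := fun x => by
    rw [hT, add_pow_char_pow, hbar, add_comm]
  have hTsmul : ∀ c x : K, c ^ 2 ^ m = c → T (c * x) = c * T x := fun c x hc => by
    rw [hT, hT, mul_pow, hc, mul_add]
  have hT0 : ∀ x, T x = 0 ↔ x ^ 2 ^ m = x := fun x => by
    rw [hT, CharTwo.add_eq_zero, eq_comm]
  have hTadj : ∀ x y, Algebra.trace (ZMod 2) K (x * T y) = Algebra.trace (ZMod 2) K (T x * y) := by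
    intro x y
    rw [hT, hT, mul_add, add_mul, map_add, map_add, ← trace_pow_two_pow m (x * y ^ 2 ^ m), mul_pow,
      hbar]
  let L : K →+ K := T.comp (iterateFrobenius K 2 i : K →+ K)
  have hL : ∀ x, L x = T (x ^ 2 ^ i) := fun x => rfl
  have hFL : ∀ x, F x = x * L x := fun x => by
    rw [hF, hL, hT, pow_add, pow_add, pow_one, ← mul_add, ← pow_mul, ← pow_add, add_comm i m]
  have hL0 : ∀ x, L x = 0 ↔ x ^ 2 ^ m = x := fun x => by
    rw [hL, hT0, pow_right_comm]
    exact (iterateFrobenius K 2 i).injective.eq_iff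
  have hLsurj : ∀ w, ∃ v, L v = T w := fun w => by
    obtain ⟨v, hv⟩ := (Finite.injective_iff_surjective.mp (iterateFrobenius K 2 i).injective) w
    exact ⟨v, congrArg T hv⟩
  suffices h : {a : K | ¬ IsBent m F a} = {a : K | a ^ 2 ^ m = a} by
    rw [h, ncard_fixed_pow m hm hcard]
  ext a
  rw [Set.mem_ofPred_eq, Set.mem_ofPred_eq]
  constructor
  · contrapose!
    intro ha
    have hTa : T a ≠ 0 := fun h => ha ((hT0 a).mp h)
    refine isBent_of_derivative_nonconstant m hcard F a
      (fun u => (Algebra.trace (ZMod 2) K : K →+ ZMod 2).comp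
        ((AddMonoidHom.mulLeft (a * u)).comp L + AddMonoidHom.mulLeft (a * L u)))
      (fun u v => ?_) fun u hu => ?_
    · change _ = _ + Algebra.trace (ZMod 2) K (a * u * L v + a * L u * v)
      rw [← map_add, ← map_add, hFL, hFL, hFL, map_add]
      congr 1
      ring
    · replace hu : ∀ v, Algebra.trace (ZMod 2) K (a * u * L v + a * L u * v) = 0 := hu
      have hLu : L u = 0 := by
        have h : T (L u * a) = 0 := trace_nondegenerate_two fun w => by
          have h := hu (T w)
          rwa [(hL0 _).mpr (hTfix w), mul_zero, zero_add, hTadj, mul_comm a] at h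
        rw [hTsmul (L u) a (hTfix _)] at h
        exact (mul_eq_zero.mp h).resolve_right hTa
      have h : T (u * a) = 0 := trace_nondegenerate_two fun w => by
        obtain ⟨v, hv⟩ := hLsurj w
        have h := hu v
        rwa [hLu, mul_zero, zero_mul, add_zero, hv, hTadj, mul_comm a] at h
      rw [hTsmul _ _ ((hL0 u).mp hLu)] at h
      exact (mul_eq_zero.mp h).resolve_right hTa
  · intro ha
    refine not_isBent_of_invariant m F a 1 one_ne_zero fun v => ?_
    have h1 : L 1 = 0 := (hL0 1).mpr (one_pow _)
    have h2 : Algebra.trace (ZMod 2) K (a * L v) = 0 := by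
      rw [hL, hTadj, (hT0 a).mpr ha, zero_mul, map_zero]
    rw [hFL, hFL, map_add, h1, add_zero, add_mul, one_mul, mul_add, map_add, h2, add_zero]
end

section
/- Let n = 2m with 0 ≤ i ≤ m, and let F : F_{2^n} → F_{2^n} be given by F(x) = x^{2^i+1} + x^{2^{m+i}+2^m}. Then F does not have the maximal number of bent components, i.e. #S_F > 2^m. -/
open Finset

/-- The absolute trace is invariant under powers of the Frobenius. -/
theorem trace_pow_two_pow_s1 {K : Type*} [Field K] [Fintype K] [Algebra (ZMod 2) K] (k : ℕ) (x : K) :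
    Algebra.trace (ZMod 2) K (x ^ 2 ^ k) = Algebra.trace (ZMod 2) K x := by
  induction k with
  | zero => simp
  | succ k ih =>
    have h := Algebra.trace_eq_of_algEquiv
      (FiniteField.frobeniusAlgEquivOfAlgebraic (ZMod 2) K) (x ^ 2 ^ k)
    rw [FiniteField.coe_frobeniusAlgEquivOfAlgebraic, ZMod.card] at h
    rw [pow_succ, pow_mul, h, ih]

/-- The trace of `a · (y + y^{2^m})` only depends on the relative trace `a + a^{2^m}`. -/
theorem trace_mul_add_pow {K : Type*} [Field K] [Fintype K] [Algebra (ZMod 2) K] {m : ℕ}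
    (hcard : Fintype.card K = 2 ^ (2 * m)) (a y : K) :
    Algebra.trace (ZMod 2) K (a * (y + y ^ 2 ^ m)) =
      Algebra.trace (ZMod 2) K ((a + a ^ 2 ^ m) * y) := by
  have hy : (y ^ 2 ^ m) ^ 2 ^ m = y := by
    rw [← pow_mul, ← pow_add, ← two_mul, ← hcard, FiniteField.pow_card]
  have h := trace_pow_two_pow_s1 m (a * y ^ 2 ^ m)
  rw [mul_pow, hy] at h
  rw [mul_add, add_mul, map_add, map_add, h]

/-- The absolute trace of `1` vanishes in even degree. -/
theorem trace_one_eq_zero {K : Type*} [Field K] [Fintype K] [Algebra (ZMod 2) K] {m : ℕ}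
    (hcard : Fintype.card K = 2 ^ (2 * m)) : Algebra.trace (ZMod 2) K 1 = 0 := by
  have hrank : Module.finrank (ZMod 2) K = 2 * m := by
    have h := Module.card_eq_pow_finrank (K := ZMod 2) (V := K)
    rw [hcard, ZMod.card] at h
    exact (Nat.pow_right_injective le_rfl h).symm
  have h := Algebra.trace_algebraMap (S := K) (1 : ZMod 2)
  rw [map_one, hrank, mul_smul, two_smul, CharTwo.add_self_eq_zero] at h
  exact h

/-- If `a · F` has a trace invariant under translation by `1`, then some Walsh value vanishes,
so the component `F_a` is not bent. -/
theorem not_isBent_of_trace_add_one {K : Type*} [Field K] [Fintype K] [Algebra (ZMod 2) K]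
    (m : ℕ) {F : K → K} {a : K}
    (h : ∀ v, Algebra.trace (ZMod 2) K (a * F (v + 1)) = Algebra.trace (ZMod 2) K (a * F v)) :
    ¬ IsBent m F a := by
  obtain ⟨ω, hω⟩ := Algebra.trace_surjective (ZMod 2) K 1
  have hW : walsh F a ω = -walsh F a ω := by
    conv_lhs => rw [walsh, ← Equiv.sum_comp (Equiv.addRight (1 : K))]
    rw [walsh, ← Finset.sum_neg_distrib]
    refine Finset.sum_congr rfl fun v _ => ?_
    rw [Equiv.coe_addRight, h, mul_add, mul_one, map_add, hω, ← add_assoc]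
    generalize Algebra.trace (ZMod 2) K (a * F v) + Algebra.trace (ZMod 2) K (ω * v) = t
    revert t
    decide
  intro hb
  have hpos : (0 : ℤ) < 2 ^ m := by positivity
  rcases hb ω with h | h <;> omega

/-- The relative trace `a ↦ a + a^{2^m}` as an additive map. -/
noncomputable def relTrace (K : Type*) [Field K] [CharP K 2] (m : ℕ) : K →+ K :=
  AddMonoidHom.id K + (iterateFrobenius K 2 m).toAddMonoidHom

theorem relTrace_apply {K : Type*} [Field K] [CharP K 2] (m : ℕ) (a : K) :
    relTrace K m a = a + a ^ 2 ^ m := rfl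

theorem card_ker_relTrace_le {K : Type*} [Field K] [CharP K 2] [Fintype K] {m : ℕ} (hm : 0 < m) :
    Nat.card (relTrace K m).ker ≤ 2 ^ m := by
  classical
  have hp : 1 < 2 ^ m := Nat.one_lt_two_pow hm.ne'
  have hne := FiniteField.X_pow_card_sub_X_ne_zero K hp
  have hsub : ((relTrace K m).ker : Set K) ⊆
      ((Polynomial.X ^ 2 ^ m - Polynomial.X : Polynomial K).roots.toFinset : Set K) := by
    intro x hx
    have hx' : x + x ^ 2 ^ m = 0 := hx
    rw [Finset.mem_coe, Multiset.mem_toFinset, Polynomial.mem_roots hne]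
    simp [Polynomial.IsRoot, CharTwo.sub_eq_add, add_comm, hx']
  calc Nat.card (relTrace K m).ker
      = ((relTrace K m).ker : Set K).ncard := rfl
    _ ≤ _ := Set.ncard_le_ncard hsub (Finset.finite_toSet _)
    _ = _ := Set.ncard_coe_finset _
    _ ≤ _ := Multiset.toFinset_card_le _
    _ ≤ _ := Polynomial.card_roots' _
    _ = 2 ^ m := FiniteField.X_pow_card_sub_X_natDegree_eq K hp

theorem range_relTrace_le_ker {K : Type*} [Field K] [CharP K 2] [Fintype K] {m : ℕ}
    (hcard : Fintype.card K = 2 ^ (2 * m)) : (relTrace K m).range ≤ (relTrace K m).ker := by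
  rintro _ ⟨a, rfl⟩
  have ha : (a ^ 2 ^ m) ^ 2 ^ m = a := by
    rw [← pow_mul, ← pow_add, ← two_mul, ← hcard, FiniteField.pow_card]
  rw [AddMonoidHom.mem_ker, relTrace_apply, relTrace_apply, add_pow_char_pow, ha, add_comm (a ^ _),
    CharTwo.add_self_eq_zero]

/-- The kernel of the relative trace has `2^m` elements and equals its range. -/
theorem card_ker_and_range_eq_ker {K : Type*} [Field K] [CharP K 2] [Fintype K] {m : ℕ}
    (hm : 0 < m) (hcard : Fintype.card K = 2 ^ (2 * m)) :
    Nat.card (relTrace K m).ker = 2 ^ m ∧ (relTrace K m).range = (relTrace K m).ker := by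
  have hker := card_ker_relTrace_le (K := K) hm
  have hrange : Nat.card (relTrace K m).range ≤ Nat.card (relTrace K m).ker :=
    AddSubgroup.card_le_of_le (range_relTrace_le_ker hcard)
  have hmul : Nat.card (relTrace K m).ker * Nat.card (relTrace K m).range = 2 ^ m * 2 ^ m := by
    rw [← AddSubgroup.index_ker, AddSubgroup.card_mul_index, Nat.card_eq_fintype_card, hcard,
      two_mul, pow_add]
  have hpos : 0 < 2 ^ m := by positivity
  have hk : Nat.card (relTrace K m).ker = 2 ^ m := by nlinarith
  refine ⟨hk, AddSubgroup.eq_of_le_of_card_ge (range_relTrace_le_ker hcard) ?_⟩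
  rw [hk] at hmul ⊢
  exact (Nat.eq_of_mul_eq_mul_left hpos hmul).ge

/-- If `n = 2m`, `0 ≤ i ≤ m`, then `F(x) = x^{2^i+1} + x^{2^{m+i}+2^m}` over `F_{2^n}` does not
have the maximal number of bent components, i.e. `#S_F > 2^m`. -/
theorem stmt1 (m n : ℕ) (hm : 0 < m) (hn : n = 2 * m)
    (K : Type*) [Field K] [Fintype K] [Algebra (ZMod 2) K]
    (hcard : Fintype.card K = 2 ^ n)
    (i : ℕ) (hi : i ≤ m)
    (F : K → K) (hF : ∀ x, F x = x ^ (2 ^ i + 1) + x ^ (2 ^ (m + i) + 2 ^ m)) :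
    2 ^ m < Set.ncard {a : K | ¬ IsBent m F a} := by
  subst hn
  have : CharP K 2 := charP_of_injective_algebraMap (algebraMap (ZMod 2) K).injective 2
  have htrace (a v : K) : Algebra.trace (ZMod 2) K (a * F v) =
      Algebra.trace (ZMod 2) K (relTrace K m a * v ^ (2 ^ i + 1)) := by
    rw [relTrace_apply, ← trace_mul_add_pow hcard, hF, ← pow_mul, add_mul, ← pow_add, one_mul,
      add_comm i]
  have hone (v : K) : Algebra.trace (ZMod 2) K ((v + 1) ^ (2 ^ i + 1)) =
      Algebra.trace (ZMod 2) K (v ^ (2 ^ i + 1)) := by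
    have hexp : (v + 1) ^ (2 ^ i + 1) = v ^ (2 ^ i + 1) + v ^ 2 ^ i + v + 1 := by
      rw [pow_succ, add_pow_char_pow, one_pow]
      ring
    rw [hexp, map_add, map_add, map_add, trace_pow_two_pow_s1, trace_one_eq_zero hcard, add_zero,
      add_assoc, CharTwo.add_self_eq_zero, add_zero]
  obtain ⟨hk, hr⟩ := card_ker_and_range_eq_ker (K := K) hm hcard
  obtain ⟨b, hb⟩ : (1 : K) ∈ (relTrace K m).range := by
    rw [hr, AddMonoidHom.mem_ker, relTrace_apply, one_pow, CharTwo.add_self_eq_zero]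
  have hb_not_mem : b ∉ ((relTrace K m).ker : Set K) := by
    simp [AddMonoidHom.mem_ker, hb]
  have hsub : insert b ((relTrace K m).ker : Set K) ⊆ {a : K | ¬ IsBent m F a} := by
    rintro a (rfl | ha)
    · refine not_isBent_of_trace_add_one m fun v => ?_
      rw [htrace, htrace, hb, one_mul, one_mul, hone]
    · refine not_isBent_of_trace_add_one m fun v => ?_
      rw [htrace, htrace, (show relTrace K m a = 0 from ha), zero_mul, zero_mul]
  calc 2 ^ m < ((relTrace K m).ker : Set K).ncard + 1 := Nat.lt_succ_of_le hk.ge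
    _ = (insert b ((relTrace K m).ker : Set K)).ncard :=
      (Set.ncard_insert_of_notMem hb_not_mem).symm
    _ ≤ _ := Set.ncard_le_ncard hsub
end

section
/- Let F(x) = x^{d_1} + x^{d_2} on F_{2^n} with d_1, d_2 ∈ {1, …, N−1}. Then for every a ∈ F_{2^n}^* and every b ∈ F_{2^n}, the integer W_{F_a}(b) is divisible by 2^{ν_{d_1,d_2}}. -/
open Finset

/-- `wt₂(j)`: the binary digit sum of the representative of `j mod N` in `{0, …, N−1}`. -/
def wt2 (N : ℕ) (j : ℤ) : ℕ := (Nat.digits 2 (j % (N : ℤ)).toNat).sum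

/-- `𝒥 = ({0,…,N−1} × {0,…,N−1}) \ {(0,0)}`. -/
def JJ (N : ℕ) : Finset (ℕ × ℕ) := ((Finset.range N) ×ˢ (Finset.range N)).erase (0, 0)

/-- `V_{d₁,d₂}(j₁,j₂) = wt₂(j₁) + wt₂(j₂) + wt₂(−d₁j₁ − d₂j₂)`. -/
def Vfun (N d₁ d₂ : ℕ) (p : ℕ × ℕ) : ℕ :=
  wt2 N (p.1 : ℤ) + wt2 N (p.2 : ℤ) + wt2 N (-((d₁ : ℤ) * p.1 + (d₂ : ℤ) * p.2))

/-- `ν_{d₁,d₂} = min{V_{d₁,d₂}(j₁,j₂) : (j₁,j₂) ∈ 𝒥}`. -/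
noncomputable def nuMin (N d₁ d₂ : ℕ) : ℕ := sInf ((Vfun N d₁ d₂) '' (JJ N : Set (ℕ × ℕ)))

/-- The binary digit sum satisfies the obvious recursion. -/
lemma digits_two_sum_eq (j : ℕ) :
    (Nat.digits 2 j).sum = j % 2 + (Nat.digits 2 (j / 2)).sum := by
  rcases Nat.eq_zero_or_pos j with rfl | hj
  · simp
  · rw [Nat.digits_def' one_lt_two hj, List.sum_cons]

/-- Adding a leading binary digit increases the digit sum by one. -/
lemma digits_two_sum_add_two_pow (i k : ℕ) (hk : k < 2 ^ i) :
    (Nat.digits 2 (k + 2 ^ i)).sum = (Nat.digits 2 k).sum + 1 := by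
  induction i generalizing k with
  | zero =>
    obtain rfl : k = 0 := by simpa using hk
    simp
  | succ i ih =>
    rw [pow_succ] at hk ⊢
    rw [digits_two_sum_eq (k + _), digits_two_sum_eq k,
      show (k + 2 ^ i * 2) / 2 = k / 2 + 2 ^ i by omega, ih _ (by omega)]
    omega

/-- The binary digit sums of complementary `n`-bit numbers add up to `n`. -/
lemma digits_two_sum_add_compl (n j : ℕ) (hj : j < 2 ^ n) :
    (Nat.digits 2 j).sum + (Nat.digits 2 (2 ^ n - 1 - j)).sum = n := by
  induction n generalizing j with
  | zero =>
    obtain rfl : j = 0 := by simpa using hj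
    simp
  | succ n ih =>
    rw [pow_succ] at hj ⊢
    rw [digits_two_sum_eq j, digits_two_sum_eq (_ - 1 - j),
      show (2 ^ n * 2 - 1 - j) / 2 = 2 ^ n - 1 - j / 2 by omega]
    have := ih (j / 2) (by omega)
    omega

/-- If the last `i` binary digits of `b` are ones, then `b.choose k` is odd for `k < 2 ^ i`. -/
lemma odd_choose_of_lt_two_pow (i u k : ℕ) (hk : k < 2 ^ i) :
    Odd ((2 ^ i * u + (2 ^ i - 1)).choose k) := by
  induction i generalizing k with
  | zero =>
    obtain rfl : k = 0 := by simpa using hk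
    simp
  | succ i ih =>
    rw [pow_succ] at hk ⊢
    have hpos : 0 < 2 ^ i := by positivity
    have h := Choose.choose_modEq_choose_mod_mul_choose_div_nat (p := 2)
      (n := 2 ^ i * 2 * u + (2 ^ i * 2 - 1)) (k := k)
    rw [mul_right_comm, show (2 ^ i * u * 2 + (2 ^ i * 2 - 1)) % 2 = 1 by omega,
      show (2 ^ i * u * 2 + (2 ^ i * 2 - 1)) / 2 = 2 ^ i * u + (2 ^ i - 1) by omega,
      show Nat.choose 1 (k % 2) = 1 by
        rcases Nat.mod_two_eq_zero_or_one k with h | h <;> simp [h], one_mul] at h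
    rw [mul_right_comm, Nat.odd_iff, h, ← Nat.odd_iff]
    exact ih _ (by omega)

section Lift

variable {K R : Type*} [Field K] [Fintype K] [CommRing R] [IsDomain R]

/-- Powers of an injective multiplicative lift of a finite field sum to zero,
unless the exponent is a multiple of the order of the unit group. -/
lemma sum_lift_pow_eq_zero (T : K →*₀ R) (hT : Function.Injective T) {e : ℕ}
    (he : ¬ Fintype.card K - 1 ∣ e) : ∑ v : K, T v ^ e = 0 := by
  rw [← FiniteField.forall_pow_eq_one_iff K e] at he
  push Not at he
  obtain ⟨x, hx⟩ := he
  refine eq_zero_of_mul_eq_self_left (b := T x ^ e) ?_ ?_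
  · rw [← map_pow, ← map_one T]
    intro h
    exact hx (Units.ext (by simpa using hT h))
  · rw [Finset.mul_sum]
    simp_rw [← mul_pow, ← map_mul]
    exact x.mulLeft_bijective.sum_comp (fun v => T v ^ e)

lemma sum_geom_lift (T : K →*₀ R) (hT : Function.Injective T) {N : ℕ}
    (hN : Fintype.card K = N + 1) {z : K} (hz : z ≠ 0) (hz1 : z ≠ 1) :
    ∑ j ∈ range N, T z ^ j = 0 := by
  have h := mul_geom_sum (T z) N
  rw [← map_pow, show z ^ N = z ^ (Fintype.card K - 1) by rw [hN, Nat.add_sub_cancel],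
    FiniteField.pow_card_sub_one_eq_one z hz, map_one, sub_self] at h
  refine (mul_eq_zero.mp h).resolve_left (sub_ne_zero.mpr fun h => hz1 (hT ?_))
  rw [h, map_one]

/-- The sum of `y ^ a * (1 - y) ^ b` over a finite field of characteristic two. -/
lemma sum_pow_mul_one_sub_pow [CharP K 2] {N : ℕ} (hN : Fintype.card K = N + 1)
    {a b c : ℕ} (ha : 0 < a) (hab : a + b < 2 * N) (hac : a + c = N) :
    ∑ y : K, y ^ a * (1 - y) ^ b = (b.choose c : K) := by
  classical
  have hcard : (N : K) = 1 := by
    have h : ((N + 1 : ℕ) : K) = 0 := by rw [← hN, FiniteField.cast_card_eq_zero]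
    rwa [Nat.cast_add, Nat.cast_one, CharTwo.add_eq_zero] at h
  have hsum : ∑ y : K, y ^ N = 1 := by
    have h : ∀ y : K, y ^ N = 1 - if y = 0 then 1 else 0 := by
      intro y
      rcases eq_or_ne y 0 with rfl | hy
      · simp [show N ≠ 0 by omega]
      · rw [show N = Fintype.card K - 1 by omega, FiniteField.pow_card_sub_one_eq_one y hy]
        simp [hy]
    simp_rw [h]
    simp [hN, hcard]
  have hexp : ∀ y : K, y ^ a * (1 - y) ^ b =
      ∑ m ∈ range (b + 1), (b.choose m : K) * y ^ (a + m) := by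
    intro y
    rw [CharTwo.sub_eq_add, add_comm, add_pow, Finset.mul_sum]
    refine Finset.sum_congr rfl fun m _ => ?_
    rw [pow_add]
    ring
  simp_rw [hexp]
  rw [Finset.sum_comm]
  simp_rw [← Finset.mul_sum]
  rw [Finset.sum_eq_single c]
  · rw [hac, hsum, mul_one]
  · intro m hm hmc
    rw [Finset.mem_range] at hm
    have h := sum_lift_pow_eq_zero (MonoidWithZeroHom.id K) Function.injective_id (e := a + m) ?_
    · simp only [MonoidWithZeroHom.id_apply] at h
      rw [h, mul_zero]
    · rintro ⟨t, ht⟩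
      rw [show Fintype.card K - 1 = N by omega] at ht
      have h1 : t < 2 := by
        by_contra! h
        have := Nat.mul_le_mul_left N h
        omega
      interval_cases t <;> omega
  · intro hc
    rw [Finset.mem_range, not_lt] at hc
    simp [Nat.choose_eq_zero_of_lt (show b < c by omega)]

/-- The multiplicative character given by a multiplicative lift of a field. -/
def liftChar {K R : Type*} [Field K] [CommRing R] (T : K →*₀ R) : MulChar K R where
  toFun := T
  map_one' := map_one T
  map_mul' := map_mul T
  map_nonunit' a ha := by
    rw [isUnit_iff_ne_zero, not_not] at ha
    simp [ha]

lemma liftChar_pow_apply {K R : Type*} [Field K] [CommRing R] (T : K →*₀ R) {e : ℕ} (he : e ≠ 0) (x : K) :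
    (liftChar T ^ e) x = T x ^ e :=
  MulChar.pow_apply' _ he x

/-- Factors with nonzero residue may be cancelled when testing divisibility by powers of two. -/
lemma two_pow_dvd_of_dvd_mul {K R : Type*} [Field K] [CharP K 2] [CommRing R]
    [IsDomain R] (π : R →+* K) (h2 : (2 : R) ≠ 0) (hπ : ∀ r, π r = 0 → 2 ∣ r)
    {u x : R} (hu : π u ≠ 0) {s : ℕ} (h : 2 ^ s ∣ u * x) : 2 ^ s ∣ x := by
  induction s generalizing x with
  | zero => simp
  | succ s ih =>
    have hx : π x = 0 := by
      obtain ⟨r, hr⟩ := (dvd_pow_self (2 : R) s.succ_ne_zero).trans h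
      have := congrArg π hr
      rw [map_mul, map_mul, map_ofNat, CharTwo.two_eq_zero, zero_mul] at this
      exact (mul_eq_zero.mp this).resolve_left hu
    obtain ⟨y, rfl⟩ := hπ x hx
    rw [pow_succ', mul_left_comm] at h
    rw [pow_succ']
    exact mul_dvd_mul_left 2 (ih ((mul_dvd_mul_iff_left h2).mp h))

/-- Divisibility by powers of two descends from `R` to the integers. -/
lemma two_pow_dvd_int_of_dvd_cast {K R : Type*} [Field K] [CharP K 2] [CommRing R]
    [IsDomain R] (π : R →+* K) (h2 : (2 : R) ≠ 0) {z : ℤ} {s : ℕ}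
    (h : (2 : R) ^ s ∣ (z : R)) : (2 : ℤ) ^ s ∣ z := by
  induction s generalizing z with
  | zero => simp
  | succ s ih =>
    obtain ⟨r, hr⟩ := (dvd_pow_self (2 : R) s.succ_ne_zero).trans h
    have hz := congrArg π hr
    rw [map_mul, map_intCast, map_ofNat, CharTwo.two_eq_zero, zero_mul,
      CharP.intCast_eq_zero_iff K 2] at hz
    obtain ⟨y, rfl⟩ := hz
    rw [pow_succ']
    refine mul_dvd_mul_left 2 (ih ((mul_dvd_mul_iff_left h2).mp ?_))
    rw [← pow_succ']
    simpa using h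

variable (π : R →+* K) (T : K →*₀ R) (ψ : AddChar K R)

/-- The divisibility half of Stickelberger's theorem in characteristic two. -/
lemma two_pow_dvd_gauss_sum [CharP K 2] (hπT : ∀ x, π (T x) = x)
    (h2 : (2 : R) ≠ 0) (hπ : ∀ r, π r = 0 → 2 ∣ r) (hψ : ∀ x, π (ψ x) = 1)
    {n N : ℕ} (hN : Fintype.card K = N + 1) (hn : N + 1 = 2 ^ n) (j : ℕ) (hj0 : 0 < j)
    (hjN : j < N) : 2 ^ (Nat.digits 2 j).sum ∣ ∑ y : K, T y ^ (N - j) * ψ y := by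
  have hT : Function.Injective T := Function.LeftInverse.injective hπT
  have hcard : Fintype.card K - 1 = N := by omega
  have hbase : ∀ k, 0 < k → k < N → (2 : R) ∣ ∑ y : K, T y ^ (N - k) * ψ y := by
    intro k hk hkN
    apply hπ
    have h := sum_lift_pow_eq_zero (MonoidWithZeroHom.id K) Function.injective_id (e := N - k)
      (by rw [hcard]; exact Nat.not_dvd_of_pos_of_lt (by omega) (by omega))
    simpa [hπT, hψ] using h
  have hgauss : ∀ e, e ≠ 0 → gaussSum (liftChar T ^ e) ψ = ∑ y : K, T y ^ e * ψ y := by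
    intro e he
    exact Finset.sum_congr rfl fun y _ => by rw [liftChar_pow_apply T he]
  induction j using Nat.strong_induction_on with
  | _ j ih =>
    obtain ⟨i, hij, hji⟩ : ∃ i, 2 ^ i ≤ j ∧ j < 2 ^ (i + 1) :=
      ⟨Nat.log 2 j, Nat.pow_log_le_self 2 hj0.ne', Nat.lt_pow_succ_log_self one_lt_two j⟩
    obtain ⟨k, rfl⟩ : ∃ k, j = k + 2 ^ i := ⟨j - 2 ^ i, by omega⟩
    have hki : k < 2 ^ i := by rw [pow_succ] at hji; omega
    have hpos : 0 < 2 ^ i := by positivity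
    rw [digits_two_sum_add_two_pow i k hki]
    rcases Nat.eq_zero_or_pos k with rfl | hk
    · simpa using hbase _ hj0 hjN
    have hper : liftChar T ^ (N - k) * liftChar T ^ (N - 2 ^ i) =
        liftChar T ^ (N - (k + 2 ^ i)) := by
      have h1 : liftChar T ^ N = 1 := by
        ext x
        rw [MulChar.pow_apply_coe, MulChar.one_apply_coe]
        change T x ^ N = 1
        rw [← map_pow, ← hcard, FiniteField.pow_card_sub_one_eq_one _ x.ne_zero, map_one]
      rw [← pow_add, show N - k + (N - 2 ^ i) = N + (N - (k + 2 ^ i)) by omega, pow_add, h1,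
        one_mul]
    have hne : liftChar T ^ (N - (k + 2 ^ i)) ≠ 1 := by
      intro h
      have hdvd : Fintype.card K - 1 ∣ N - (k + 2 ^ i) := by
        rw [← FiniteField.forall_pow_eq_one_iff K]
        intro x
        have hx := congrArg (fun χ : MulChar K R => χ x) h
        simp only [MulChar.pow_apply_coe, MulChar.one_apply_coe] at hx
        change T x ^ _ = 1 at hx
        rw [← map_pow, ← map_one T] at hx
        exact Units.ext (by simpa using hT hx)
      rw [hcard] at hdvd
      exact Nat.not_dvd_of_pos_of_lt (by omega) (by omega) hdvd
    have hmul := jacobiSum_mul_nontrivial (hper ▸ hne) ψ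
    rw [hper, hgauss _ (by omega), hgauss _ (by omega), hgauss _ (by omega)] at hmul
    refine two_pow_dvd_of_dvd_mul π h2 hπ
      (u := jacobiSum (liftChar T ^ (N - k)) (liftChar T ^ (N - 2 ^ i))) ?_ ?_
    · have hJ : π (jacobiSum (liftChar T ^ (N - k)) (liftChar T ^ (N - 2 ^ i))) =
          ((N - 2 ^ i).choose k : K) := by
        rw [← sum_pow_mul_one_sub_pow hN (a := N - k) (b := N - 2 ^ i) (c := k) (by omega)
          (by omega) (by omega), jacobiSum, map_sum]
        refine Finset.sum_congr rfl fun y _ => ?_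
        rw [liftChar_pow_apply T (by omega), liftChar_pow_apply T (by omega)]
        simp [hπT]
      rw [hJ, Ne, CharP.cast_eq_zero_iff K 2, ← even_iff_two_dvd, Nat.not_even_iff_odd]
      have hin : i < n := (Nat.pow_lt_pow_iff_right one_lt_two).mp (by omega)
      obtain ⟨t, rfl⟩ := Nat.exists_eq_add_of_lt hin
      obtain ⟨w, hw⟩ : ∃ w, 2 ^ t = w + 1 := Nat.exists_eq_succ_of_ne_zero (by positivity)
      have hexp : 2 ^ (i + t + 1) = 2 ^ i * (2 * w) + 2 * 2 ^ i := by
        rw [pow_succ, pow_add, hw]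
        ring
      rw [show N - 2 ^ i = 2 ^ i * (2 * w) + (2 ^ i - 1) by omega]
      exact odd_choose_of_lt_two_pow i (2 * w) k hki
    · rw [mul_comm, hmul, pow_succ]
      exact mul_dvd_mul (ih k (by omega) hk (by omega)) (hbase _ hpos (by omega))

/-- Coefficients of the interpolation polynomial of `N` times an additive character. -/
def lagrangeCoeff {K R : Type*} [Field K] [Fintype K] [CommRing R] (T : K →*₀ R)
    (ψ : AddChar K R) (N j : ℕ) : R :=
  if j = 0 then N else if j = N then -(N + 1) else ∑ y : K, T y ^ (N - j) * ψ y

/-- A nontrivial additive character as a polynomial in the multiplicative lift. -/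
lemma sum_lagrangeCoeff (hT : Function.Injective T) (hψ : ψ ≠ 1)
    {N : ℕ} (hN : Fintype.card K = N + 1) (hN0 : 0 < N) (y : K) :
    ∑ j ∈ range (N + 1), lagrangeCoeff T ψ N j * T y ^ j = N * ψ y := by
  classical
  obtain ⟨M, rfl⟩ : ∃ M, N = M + 1 := ⟨N - 1, by omega⟩
  have hcard : Fintype.card K - 1 = M + 1 := by omega
  rcases eq_or_ne y 0 with rfl | hy
  · rw [Finset.sum_eq_single 0]
    · simp [lagrangeCoeff]
    · intro j _ hj
      simp [hj]
    · simp
  have hone : ∀ x : K, x ≠ 0 → T x ^ (M + 1) = 1 := fun x hx => by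
    rw [← map_pow, ← hcard, FiniteField.pow_card_sub_one_eq_one x hx, map_one]
  have hsplit : ∑ x : K, T x ^ (M + 1) * ψ x = -1 := by
    have h := AddChar.sum_eq_zero_of_ne_one hψ
    rw [Fintype.sum_eq_add_sum_compl 0, AddChar.map_zero_eq_one] at h
    rw [Fintype.sum_eq_add_sum_compl 0, map_zero, zero_pow (by omega), zero_mul, zero_add,
      eq_neg_iff_add_eq_zero, add_comm, ← h]
    congr 1
    refine Finset.sum_congr rfl fun x hx => ?_
    rw [hone x (by simpa using hx), one_mul]
  have hfull : ∑ j ∈ range (M + 1), (∑ x : K, T x ^ (M + 1 - j) * ψ x) * T y ^ j =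
      (M + 1 : ℕ) * ψ y := by
    simp_rw [Finset.sum_mul]
    rw [Finset.sum_comm, Finset.sum_eq_single y]
    · rw [Finset.sum_congr rfl (g := fun _ => ψ y)]
      · simp
      · intro j hj
        rw [Finset.mem_range] at hj
        rw [mul_right_comm, ← pow_add, show M + 1 - j + j = M + 1 by omega, hone y hy, one_mul]
    · intro x _ hxy
      rcases eq_or_ne x 0 with rfl | hx
      · refine Finset.sum_eq_zero fun j hj => ?_
        rw [Finset.mem_range] at hj
        rw [map_zero, zero_pow (by omega), zero_mul, zero_mul]
      · have h := sum_geom_lift T hT hN (z := y / x) (div_ne_zero hy hx)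
          (fun h => hxy ((div_eq_one_iff_eq hx).mp h).symm)
        rw [← mul_zero (ψ x), ← h, Finset.mul_sum]
        refine Finset.sum_congr rfl fun j hj => ?_
        rw [Finset.mem_range] at hj
        have h1 : T (y / x) ^ j = T x ^ (M + 1 - j) * T y ^ j := by
          have hxj : T x ^ j ≠ 0 := pow_ne_zero _ ((map_ne_zero_iff T hT).mpr hx)
          apply mul_right_cancel₀ hxj
          rw [← mul_pow, ← map_mul, div_mul_cancel₀ y hx, mul_right_comm, ← pow_add,
            show M + 1 - j + j = M + 1 by omega, hone x hx, one_mul]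
        rw [h1]
        ring
    · simp
  rw [Finset.sum_range_succ, Finset.sum_range_succ', ← hfull, Finset.sum_range_succ', Nat.sub_zero,
    hsplit, hone y hy]
  have hmid : ∀ j ∈ range M, lagrangeCoeff T ψ (M + 1) (j + 1) =
      ∑ x : K, T x ^ (M + 1 - (j + 1)) * ψ x := by
    intro j hj
    rw [Finset.mem_range] at hj
    simp [lagrangeCoeff, show j ≠ M by omega]
  rw [Finset.sum_congr rfl fun j hj => by rw [hmid j hj]]
  simp only [lagrangeCoeff, if_true, if_neg M.succ_ne_zero]
  push_cast
  ring

lemma two_pow_dvd_lagrangeCoeff [CharP K 2] (hπT : ∀ x, π (T x) = x)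
    (h2 : (2 : R) ≠ 0) (hπ : ∀ r, π r = 0 → 2 ∣ r) (hψ : ∀ x, π (ψ x) = 1)
    {n N : ℕ} (hN : Fintype.card K = N + 1) (hn : N + 1 = 2 ^ n) (j : ℕ) (hjN : j < N) :
    2 ^ (Nat.digits 2 j).sum ∣ lagrangeCoeff T ψ N j := by
  rcases Nat.eq_zero_or_pos j with rfl | hj
  · simp
  · rw [lagrangeCoeff, if_neg hj.ne', if_neg hjN.ne]
    exact two_pow_dvd_gauss_sum π T ψ hπT h2 hπ hψ hN hn j hj hjN

lemma two_pow_dvd_lagrangeCoeff_self {K R : Type*} [Field K] [Fintype K] [CommRing R]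
    (T : K →*₀ R) (ψ : AddChar K R) {n N : ℕ} (hn : N + 1 = 2 ^ n) (hN0 : 0 < N) :
    2 ^ n ∣ lagrangeCoeff T ψ N N := by
  rw [lagrangeCoeff, if_neg hN0.ne', if_pos rfl]
  have : ((N : R) + 1) = 2 ^ n := by exact_mod_cast congrArg (Nat.cast (R := R)) hn
  rw [this, dvd_neg]

end Lift

lemma wt2_natCast {N j : ℕ} (hj : j < N) : wt2 N (j : ℤ) = (Nat.digits 2 j).sum := by
  rw [wt2, ← Int.natCast_mod, Int.toNat_natCast, Nat.mod_eq_of_lt hj]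

lemma wt2_neg {N d j : ℕ} (hj : j < N) (h : N ∣ d + j) :
    wt2 N (-(d : ℤ)) = (Nat.digits 2 j).sum := by
  rw [← wt2_natCast hj, wt2, wt2]
  have hmod : -(d : ℤ) % N = (j : ℤ) % N := by
    refine (Int.modEq_iff_dvd.mpr ?_ : -(d : ℤ) ≡ j [ZMOD N])
    rw [sub_neg_eq_add, add_comm]
    exact_mod_cast h
  rw [hmod]

lemma nuMin_le {N d₁ d₂ j₁ j₂ : ℕ} (h₁ : j₁ < N) (h₂ : j₂ < N) (h : ¬ (j₁ = 0 ∧ j₂ = 0)) :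
    nuMin N d₁ d₂ ≤ Vfun N d₁ d₂ (j₁, j₂) := by
  refine Nat.sInf_le ⟨(j₁, j₂), ?_, rfl⟩
  simp [JJ, h₁, h₂, h]

lemma nuMin_le_of_dvd {N d₁ d₂ j₁ j₂ j₃ : ℕ} (h₁ : j₁ < N) (h₂ : j₂ < N) (h₃ : j₃ < N)
    (h : ¬ (j₁ = 0 ∧ j₂ = 0)) (hdvd : N ∣ d₁ * j₁ + d₂ * j₂ + j₃) :
    nuMin N d₁ d₂ ≤ (Nat.digits 2 j₁).sum + (Nat.digits 2 j₂).sum + (Nat.digits 2 j₃).sum := by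
  have := nuMin_le (d₁ := d₁) (d₂ := d₂) h₁ h₂ h
  rw [Vfun, wt2_natCast h₁, wt2_natCast h₂] at this
  have h3 := wt2_neg h₃ hdvd
  push_cast at h3
  rwa [h3] at this

/-- The minimum is at most `n`, by averaging over the pairs `(1, 0)` and `(N - 1, 0)`. -/
lemma nuMin_le_exponent {n N d₁ d₂ : ℕ} (hn : N + 1 = 2 ^ n) (hN : 1 < N)
    (hd₁ : 1 ≤ d₁) (hd₁' : d₁ < N) : nuMin N d₁ d₂ ≤ n := by
  have h1 := nuMin_le_of_dvd (N := N) (d₁ := d₁) (d₂ := d₂) (j₁ := 1) (j₂ := 0) (j₃ := N - d₁) hN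
    (by omega) (by omega) (by simp) ⟨1, by omega⟩
  have h2 := nuMin_le_of_dvd (N := N) (d₁ := d₁) (d₂ := d₂) (j₁ := N - 1) (j₂ := 0) (j₃ := d₁) (by omega)
    (by omega) (by omega) (by omega) ⟨d₁, by
      obtain ⟨M, rfl⟩ : ∃ M, N = M + 1 := ⟨N - 1, by omega⟩
      simp only [Nat.add_sub_cancel]
      ring⟩
  have c1 := digits_two_sum_add_compl n 1 (by omega)
  have c2 := digits_two_sum_add_compl n d₁ (by omega)
  rw [show 2 ^ n - 1 = N by omega] at c1 c2
  simp only [Nat.digits_zero, List.sum_nil] at h1 h2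
  omega

/-- The sign character of the absolute trace with values in a commutative ring. -/
noncomputable def traceSignChar (K R : Type*) [Field K] [Algebra (ZMod 2) K] [CommRing R] :
    AddChar K R :=
  (AddChar.zmodChar 2 (ζ := (-1 : R)) (by norm_num)).compAddMonoidHom
    (Algebra.trace (ZMod 2) K).toAddMonoidHom

lemma traceSignChar_apply {K R : Type*} [Field K] [Algebra (ZMod 2) K] [CommRing R] (x : K) :
    traceSignChar K R x = if Algebra.trace (ZMod 2) K x = 0 then 1 else -1 := by
  change (-1 : R) ^ (Algebra.trace (ZMod 2) K x).val = _
  generalize Algebra.trace (ZMod 2) K x = t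
  obtain rfl | rfl : t = 0 ∨ t = 1 := by
    revert t
    decide
  · simp
  · simp [ZMod.val_one]

lemma traceSignChar_ne_one {K R : Type*} [Field K] [Finite K] [Algebra (ZMod 2) K] [CommRing R]
    [IsDomain R] (h2 : (2 : R) ≠ 0) : traceSignChar K R ≠ 1 := by
  obtain ⟨x, hx⟩ := Algebra.trace_surjective (ZMod 2) K 1
  intro h
  have h1 : traceSignChar K R x = 1 := by rw [h, AddChar.one_apply]
  rw [traceSignChar_apply, hx, if_neg one_ne_zero] at h1
  exact h2 (by linear_combination -h1)

lemma cast_walsh {K R : Type*} [Field K] [Fintype K] [Algebra (ZMod 2) K] [CommRing R]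
    (F : K → K) (a b : K) :
    ((walsh F a b : ℤ) : R) = ∑ v : K, traceSignChar K R (a * F v + b * v) := by
  rw [walsh, Int.cast_sum]
  refine Finset.sum_congr rfl fun v _ => ?_
  rw [traceSignChar_apply, map_add]
  split_ifs <;> simp

lemma two_pow_nuMin_dvd_walsh {K R : Type*} [Field K] [Fintype K] [Algebra (ZMod 2) K] [CharP K 2]
    [CommRing R] [IsDomain R] (π : R →+* K) (T : K →*₀ R) (hπT : ∀ x, π (T x) = x)
    (h2 : (2 : R) ≠ 0) (hπ : ∀ r, π r = 0 → 2 ∣ r)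
    {n N : ℕ} (hN : Fintype.card K = N + 1) (hn : N + 1 = 2 ^ n) (hN1 : 1 < N)
    {d₁ d₂ : ℕ} (hd₁ : 1 ≤ d₁) (hd₁' : d₁ < N) (a b : K) :
    (2 : ℤ) ^ nuMin N d₁ d₂ ∣ walsh (fun x : K => x ^ d₁ + x ^ d₂) a b := by
  have hT : Function.Injective T := Function.LeftInverse.injective hπT
  have hψ : ∀ x, π (traceSignChar K R x) = 1 := by
    intro x
    rw [traceSignChar_apply]
    split_ifs <;> simp [CharTwo.neg_eq]
  set ψ := traceSignChar K R
  have hle := nuMin_le_exponent (d₂ := d₂) hn hN1 hd₁ hd₁'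
  have hπN : π (N : R) ≠ 0 := by
    rw [map_natCast, Ne, CharP.cast_eq_zero_iff K 2]
    have h0 : n ≠ 0 := by
      rintro rfl
      omega
    have := dvd_pow_self 2 h0
    omega
  apply two_pow_dvd_int_of_dvd_cast π h2
  apply two_pow_dvd_of_dvd_mul π h2 hπ (u := (N : R) ^ 3) (by
    rw [map_pow]
    exact pow_ne_zero _ hπN)
  set C := lagrangeCoeff T ψ N
  have hexp := sum_lagrangeCoeff T ψ hT (traceSignChar_ne_one h2) hN (by omega)
  have hmain : (N : R) ^ 3 * (walsh (fun x : K => x ^ d₁ + x ^ d₂) a b : ℤ) =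
      ∑ j₁ ∈ range (N + 1), ∑ j₂ ∈ range (N + 1), ∑ j₃ ∈ range (N + 1),
        C j₁ * C j₂ * C j₃ * (T a ^ j₁ * T a ^ j₂ * T b ^ j₃) *
          ∑ v : K, T v ^ (d₁ * j₁ + d₂ * j₂ + j₃) := by
    have hv : ∀ v : K, (N : R) ^ 3 * ψ (a * (v ^ d₁ + v ^ d₂) + b * v) =
        ∑ j₁ ∈ range (N + 1), ∑ j₂ ∈ range (N + 1), ∑ j₃ ∈ range (N + 1),
          C j₁ * C j₂ * C j₃ * (T a ^ j₁ * T a ^ j₂ * T b ^ j₃) *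
            T v ^ (d₁ * j₁ + d₂ * j₂ + j₃) := by
      intro v
      rw [mul_add, AddChar.map_add_eq_mul, AddChar.map_add_eq_mul,
        show (N : R) ^ 3 * (ψ (a * v ^ d₁) * ψ (a * v ^ d₂) * ψ (b * v)) =
          (N * ψ (a * v ^ d₁)) * (N * ψ (a * v ^ d₂)) * (N * ψ (b * v)) by ring,
        ← hexp, ← hexp, ← hexp, Finset.sum_mul_sum, Finset.sum_mul]
      refine Finset.sum_congr rfl fun j₁ _ => ?_
      rw [Finset.sum_mul]
      refine Finset.sum_congr rfl fun j₂ _ => ?_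
      rw [Finset.mul_sum]
      refine Finset.sum_congr rfl fun j₃ _ => ?_
      simp only [map_mul, map_pow, mul_pow, pow_add, pow_mul]
      ring
    rw [cast_walsh, Finset.mul_sum, Finset.sum_congr rfl fun v _ => hv v, Finset.sum_comm]
    refine Finset.sum_congr rfl fun j₁ _ => ?_
    rw [Finset.sum_comm]
    refine Finset.sum_congr rfl fun j₂ _ => ?_
    rw [Finset.sum_comm]
    exact Finset.sum_congr rfl fun j₃ _ => (Finset.mul_sum _ _ _).symm
  rw [hmain]
  refine Finset.dvd_sum fun j₁ h₁ => Finset.dvd_sum fun j₂ h₂ => Finset.dvd_sum fun j₃ h₃ => ?_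
  rw [Finset.mem_range] at h₁ h₂ h₃
  by_cases hdvd : N ∣ d₁ * j₁ + d₂ * j₂ + j₃
  swap
  · rw [sum_lift_pow_eq_zero T hT (by rwa [hN, Nat.add_sub_cancel]), mul_zero]
    exact dvd_zero _
  have hCN : (2 : R) ^ nuMin N d₁ d₂ ∣ C N :=
    (pow_dvd_pow 2 hle).trans (two_pow_dvd_lagrangeCoeff_self T ψ hn (by omega))
  rcases eq_or_ne j₁ N with rfl | hj₁
  · exact (((hCN.mul_right _).mul_right _).mul_right _).mul_right _
  rcases eq_or_ne j₂ N with rfl | hj₂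
  · exact (((hCN.mul_left _).mul_right _).mul_right _).mul_right _
  rcases eq_or_ne j₃ N with rfl | hj₃
  · exact ((hCN.mul_left _).mul_right _).mul_right _
  have hdvdC := two_pow_dvd_lagrangeCoeff π T ψ hπT h2 hπ hψ hN hn
  by_cases h0 : j₁ = 0 ∧ j₂ = 0
  · obtain ⟨rfl, rfl⟩ := h0
    obtain rfl : j₃ = 0 := Nat.eq_zero_of_dvd_of_lt (by simpa using hdvd) (by omega)
    refine ((pow_dvd_pow 2 hle).trans ?_).mul_left _
    simp [hN, hn]
  · have hν := nuMin_le_of_dvd (by omega) (by omega) (by omega) h0 hdvd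
    refine (((pow_dvd_pow 2 hν).trans ?_).mul_right _).mul_right _
    rw [pow_add, pow_add]
    exact mul_dvd_mul (mul_dvd_mul (hdvdC _ (by omega)) (hdvdC _ (by omega)))
      (hdvdC _ (by omega))

/-- For `F(x) = x^{d₁} + x^{d₂}` over `F_{2^n}` with `d₁, d₂ ∈ {1, …, N−1}` (`N = 2^n − 1`),
every Walsh value `W_{F_a}(b)` with `a ≠ 0` is divisible by `2^{ν_{d₁,d₂}}`. -/
theorem stmt2 (m n : ℕ) (hm : 0 < m) (hn : n = 2 * m) (N : ℕ) (hN : N = 2 ^ n - 1)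
    (K : Type*) [Field K] [Fintype K] [Algebra (ZMod 2) K]
    (hcard : Fintype.card K = 2 ^ n)
    (d₁ d₂ : ℕ) (hd₁ : 1 ≤ d₁) (hd₁' : d₁ ≤ N - 1) (hd₂ : 1 ≤ d₂) (hd₂' : d₂ ≤ N - 1)
    (F : K → K) (hF : ∀ x, F x = x ^ d₁ + x ^ d₂) :
    ∀ a b : K, a ≠ 0 → (2 ^ (nuMin N d₁ d₂) : ℤ) ∣ walsh F a b := by
  intro a b _
  obtain rfl : F = fun x => x ^ d₁ + x ^ d₂ := funext hF
  have : CharP K 2 := charP_of_injective_algebraMap (algebraMap (ZMod 2) K).injective 2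
  have hpow : 2 ^ 2 ≤ 2 ^ n := Nat.pow_le_pow_right two_pos (by omega)
  let T : K →*₀ WittVector 2 K :=
    { WittVector.teichmuller 2 with map_zero' := WittVector.teichmuller_zero 2 }
  refine two_pow_nuMin_dvd_walsh (R := WittVector 2 K) (n := n) WittVector.constantCoeff T
    (fun x => WittVector.teichmuller_coeff_zero 2 x) ?_ ?_ (by omega) (by omega) (by omega)
    hd₁ (by omega) a b
  · exact_mod_cast WittVector.p_nonzero 2 K
  · intro r hr
    have h := (WittVector.mem_span_p_iff_coeff_zero_eq_zero (p := 2) r).mpr hr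
    rw [Ideal.mem_span_singleton] at h
    exact_mod_cast h
end

section
/- Let F(x) = x^{d_1} + x^{d_2} on F_{2^n} with d_1, d_2 ∈ {1, …, N−1} and s = gcd(d_1, d_2, N) > 1. Then W_{F_a}(0) ≡ 1 (mod s) for every a ∈ F_{2^n}. Consequently, if F has at least one bent component (i.e. S_F ≠ F_{2^n}), then either s divides 2^m − 1 and gcd(s, 2^m + 1) = 1, or s divides 2^m + 1 and gcd(s, 2^m − 1) = 1; more precisely, s ∣ 2^m − 1 if and only if W_{F_a}(0) = 2^m for every a ∉ S_F, and s ∣ 2^m + 1 if and only if W_{F_a}(0) = −2^m for every a ∉ S_F. -/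
open Finset

/-- In a finite cyclic group whose order is divisible by `s`, a sum of a function of `x ^ s` is
divisible by `s`. -/
theorem IsCyclic.dvd_sum_comp_pow {G : Type*} [CommGroup G] [Fintype G] [IsCyclic G]
    {s : ℕ} (hs : s ∣ Fintype.card G) (f : G → ℤ) :
    (s : ℤ) ∣ ∑ x : G, f (x ^ s) := by
  classical
  rw [Finset.sum_comp f (fun x : G => x ^ s)]
  refine Finset.dvd_sum fun b hb => ?_
  obtain ⟨y, -, rfl⟩ := Finset.mem_image.mp hb
  have hfiber : #{x : G | x ^ s = y ^ s} = s := by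
    have h := MonoidHom.card_fiber_eq_of_mem_range (powMonoidHom s : G →* G)
      (x := y ^ s) (y := 1) ⟨y, rfl⟩ ⟨1, by simp⟩
    simp only [powMonoidHom_apply] at h
    rw [h]
    have hker := IsCyclic.card_powMonoidHom_ker G s
    rw [← Nat.card_eq_fintype_card] at hs
    rw [Nat.gcd_eq_right hs] at hker
    refine (Nat.subtype_card _ fun x => ?_).symm.trans hker
    simp [MonoidHom.mem_ker]
  rw [hfiber, nsmul_eq_mul]
  exact dvd_mul_right _ _

/-- On a finite field, if `s` divides the order of the multiplicative group, then a sum of a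
function of `x ^ s` is congruent to its value at `0` modulo `s`. -/
theorem FiniteField.dvd_sum_comp_pow_sub {K : Type*} [Field K] [Fintype K]
    {s : ℕ} (hs0 : s ≠ 0) (hs : s ∣ Fintype.card K - 1) (f : K → ℤ) :
    (s : ℤ) ∣ ∑ x : K, f (x ^ s) - f 0 := by
  classical
  have hsum : ∑ x : K, f (x ^ s) = f 0 + ∑ u : Kˣ, f ((u ^ s : Kˣ) : K) := by
    rw [Fintype.sum_eq_add_sum_subtype_ne _ (0 : K), zero_pow hs0]
    congr 1
    exact (Fintype.sum_equiv unitsEquivNeZero _ _ fun u => by simp).symm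
  rw [hsum, add_sub_cancel_left]
  exact IsCyclic.dvd_sum_comp_pow (by rwa [Fintype.card_units]) fun u : Kˣ => f u

/-- If `s` divides both exponents of a binomial and the order of the multiplicative group, then
all its components have Walsh transform at `0` congruent to `1` modulo `s`. -/
theorem dvd_walsh_zero_sub_one {K : Type*} [Field K] [Fintype K] [Algebra (ZMod 2) K]
    {F : K → K} {d₁ d₂ s : ℕ} (hF : ∀ x, F x = x ^ d₁ + x ^ d₂) (hd₁ : d₁ ≠ 0) (hd₂ : d₂ ≠ 0)
    (hs₁ : s ∣ d₁) (hs₂ : s ∣ d₂) (hs : s ∣ Fintype.card K - 1) (a : K) :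
    (s : ℤ) ∣ walsh F a 0 - 1 := by
  obtain ⟨e₁, rfl⟩ := hs₁
  obtain ⟨e₂, rfl⟩ := hs₂
  obtain ⟨hs0, he₁⟩ := mul_ne_zero_iff.mp hd₁
  obtain ⟨-, he₂⟩ := mul_ne_zero_iff.mp hd₂
  have h := FiniteField.dvd_sum_comp_pow_sub hs0 hs fun y : K =>
    if Algebra.trace (ZMod 2) K (a * (y ^ e₁ + y ^ e₂)) = 0 then (1 : ℤ) else -1
  simpa [walsh, hF, pow_mul, he₁, he₂] using h

/-- Let `F(x) = x^{d₁} + x^{d₂}` over `F_{2^n}` with `s = gcd(d₁, d₂, N) > 1` (`N = 2^n − 1`).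
Then `W_{F_a}(0) ≡ 1 (mod s)` for every `a`.  Consequently, if `F` has at least one bent
component, then either `s ∣ 2^m − 1` and `gcd(s, 2^m+1) = 1`, or `s ∣ 2^m + 1` and
`gcd(s, 2^m−1) = 1`; more precisely `s ∣ 2^m − 1` iff `W_{F_a}(0) = 2^m` for all `a ∉ S_F`,
and `s ∣ 2^m + 1` iff `W_{F_a}(0) = −2^m` for all `a ∉ S_F`. -/
theorem stmt4 (m n : ℕ) (hm : 0 < m) (hn : n = 2 * m) (N : ℕ) (hN : N = 2 ^ n - 1)
    (K : Type*) [Field K] [Fintype K] [Algebra (ZMod 2) K]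
    (hcard : Fintype.card K = 2 ^ n)
    (d₁ d₂ : ℕ) (hd₁ : 1 ≤ d₁) (hd₁' : d₁ ≤ N - 1) (hd₂ : 1 ≤ d₂) (hd₂' : d₂ ≤ N - 1)
    (F : K → K) (hF : ∀ x, F x = x ^ d₁ + x ^ d₂)
    (s : ℕ) (hs : s = Nat.gcd d₁ (Nat.gcd d₂ N)) (hs1 : 1 < s) :
    (∀ a : K, (s : ℤ) ∣ walsh F a 0 - 1) ∧
    ({a : K | ¬ IsBent m F a} ≠ Set.univ →
      ((s ∣ 2 ^ m - 1 ∧ Nat.gcd s (2 ^ m + 1) = 1) ∨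
        (s ∣ 2 ^ m + 1 ∧ Nat.gcd s (2 ^ m - 1) = 1)) ∧
      ((s ∣ 2 ^ m - 1) ↔ ∀ a : K, IsBent m F a → walsh F a 0 = 2 ^ m) ∧
      ((s ∣ 2 ^ m + 1) ↔ ∀ a : K, IsBent m F a → walsh F a 0 = -(2 ^ m))) := by
  have hs₁ : s ∣ d₁ := hs ▸ Nat.gcd_dvd_left _ _
  have hs₂₃ : s ∣ Nat.gcd d₂ N := hs ▸ Nat.gcd_dvd_right _ _
  have hsN : s ∣ 2 ^ n - 1 := hN ▸ hs₂₃.trans (Nat.gcd_dvd_right _ _)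
  have hwalsh : ∀ a : K, (s : ℤ) ∣ walsh F a 0 - 1 :=
    dvd_walsh_zero_sub_one hF (by omega) (by omega) hs₁ (hs₂₃.trans (Nat.gcd_dvd_left _ _))
      (by rwa [hcard])
  have hodd : Odd s := by
    refine Odd.of_dvd_nat ?_ hsN
    exact Nat.Even.sub_odd Nat.one_le_two_pow
      ((Nat.even_pow' (by omega)).mpr even_two) odd_one
  have hcop : ∀ t, t ∣ s → t ∣ 2 → t = 1 := fun t ht ht2 =>
    Nat.eq_one_of_dvd_coprimes hodd.coprime_two_right ht ht2
  have hpow : 1 ≤ 2 ^ m := Nat.one_le_two_pow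
  have hexcl : ∀ t, t ∣ s → t ∣ 2 ^ m - 1 → t ∣ 2 ^ m + 1 → t = 1 := fun t ht h₁ h₂ => by
    refine hcop t ht ?_
    have h := Nat.dvd_sub h₂ h₁
    rwa [show 2 ^ m + 1 - (2 ^ m - 1) = 2 by omega] at h
  have hpos : ∀ a : K, walsh F a 0 = 2 ^ m → s ∣ 2 ^ m - 1 := fun a ha => by
    have h := hwalsh a
    rw [ha] at h
    zify [hpow]
    exact h
  have hneg : ∀ a : K, walsh F a 0 = -(2 ^ m) → s ∣ 2 ^ m + 1 := fun a ha => by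
    have h := hwalsh a
    rw [ha, ← dvd_neg] at h
    zify
    rwa [neg_sub, sub_neg_eq_add, add_comm] at h
  refine ⟨hwalsh, fun hne => ?_⟩
  obtain ⟨b, hb⟩ := (Set.ne_univ_iff_exists_notMem _).mp hne
  replace hb : IsBent m F b := not_not.mp hb
  refine ⟨?_, ⟨fun h a ha => ?_, fun h => hpos b (h b hb)⟩,
    ⟨fun h a ha => ?_, fun h => hneg b (h b hb)⟩⟩
  · rcases hb 0 with h | h
    · exact Or.inl ⟨hpos b h, hexcl _ (Nat.gcd_dvd_left _ _)
        ((Nat.gcd_dvd_left _ _).trans (hpos b h)) (Nat.gcd_dvd_right _ _)⟩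
    · exact Or.inr ⟨hneg b h, hexcl _ (Nat.gcd_dvd_left _ _) (Nat.gcd_dvd_right _ _)
        ((Nat.gcd_dvd_left _ _).trans (hneg b h))⟩
  · exact (ha 0).resolve_right fun h' => hs1.ne' (hexcl s dvd_rfl h (hneg a h'))
  · exact (ha 0).resolve_left fun h' => hs1.ne' (hexcl s dvd_rfl (hpos a h') h)
end

section
/- Let F : F_{2^n} → F_{2^n} be a function satisfying F(x^2) = F(x)^2 for all x (i.e. F commutes with the Frobenius σ : x ↦ x^2). If γ ∈ S_F then γ^2 ∈ S_F. Consequently, if #S_F = 2^m, then for every γ ∈ S_F the F_2-span of the Frobenius orbit {γ, γ^2, γ^4, …, γ^{2^{n−1}}} is contained in S_F. -/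
open Finset

/-- The `F₂`-span of the Frobenius orbit `{γ, γ², γ⁴, …}` of `γ`. -/
def frobSpan (K : Type*) [Field K] [Algebra (ZMod 2) K] (γ : K) : Submodule (ZMod 2) K :=
  Submodule.span (ZMod 2) (Set.range fun i : ℕ => γ ^ (2 ^ i))

/-- The trace to the prime field is invariant under squaring. -/
theorem trace_sq {K : Type*} [Field K] [Fintype K] [Algebra (ZMod 2) K] (x : K) :
    Algebra.trace (ZMod 2) K (x ^ 2) = Algebra.trace (ZMod 2) K x := by
  have h := Algebra.trace_eq_of_algEquiv (FiniteField.frobeniusAlgEquivOfAlgebraic (ZMod 2) K) x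
  simpa using h

/-- If `F` commutes with squaring, the Walsh transform is invariant under squaring both
arguments. -/
theorem walsh_sq {K : Type*} [Field K] [Fintype K] [Algebra (ZMod 2) K]
    (F : K → K) (hcomm : ∀ x, F (x ^ 2) = (F x) ^ 2) (a ω : K) :
    walsh F (a ^ 2) (ω ^ 2) = walsh F a ω := by
  unfold walsh
  refine (Fintype.sum_equiv (FiniteField.frobeniusAlgEquivOfAlgebraic (ZMod 2) K).toEquiv
    _ _ fun v => ?_).symm
  have hv : (FiniteField.frobeniusAlgEquivOfAlgebraic (ZMod 2) K).toEquiv v = v ^ 2 := by simp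
  rw [hv, hcomm, ← mul_pow, ← mul_pow, trace_sq, trace_sq]

theorem isBent_of_isBent_sq {K : Type*} [Field K] [Fintype K] [Algebra (ZMod 2) K]
    {m : ℕ} {F : K → K} (hcomm : ∀ x, F (x ^ 2) = (F x) ^ 2) {a : K}
    (h : IsBent m F (a ^ 2)) : IsBent m F a := fun ω => by
  rw [← walsh_sq F hcomm]
  exact h (ω ^ 2)

/-- A sum of the sign character of a linear functional over an `𝔽₂`-space is divisible by the
order of the space. -/
theorem card_dvd_sum_sign {V : Type*} [AddCommGroup V] [Module (ZMod 2) V] [Fintype V]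
    (f : V →ₗ[ZMod 2] ZMod 2) :
    (Fintype.card V : ℤ) ∣ ∑ v : V, if f v = 0 then 1 else -1 := by
  classical
  let ψ : AddChar V ℤ :=
    { toFun := fun v => if f v = 0 then 1 else -1
      map_zero_eq_one' := by simp
      map_add_eq_mul' := fun x y => by
        rw [map_add]
        generalize f x = s
        generalize f y = t
        revert s t
        decide }
  change _ ∣ ∑ v : V, ψ v
  rw [AddChar.sum_eq_ite]
  split_ifs <;> simp

theorem card_dvd_sum_walsh {K : Type*} [Field K] [Fintype K] [Algebra (ZMod 2) K]
    (F : K → K) (V : Submodule (ZMod 2) K) [Fintype V] :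
    (Fintype.card V : ℤ) ∣ ∑ v : V, walsh F v 0 := by
  unfold walsh
  rw [Finset.sum_comm]
  refine Finset.dvd_sum fun x _ => ?_
  have h := card_dvd_sum_sign
    ((Algebra.trace (ZMod 2) K) ∘ₗ (LinearMap.mulRight (ZMod 2) (F x)) ∘ₗ V.subtype)
  simp only [zero_mul, map_zero, add_zero]
  exact h

theorem walsh_zero_zero {K : Type*} [Field K] [Fintype K] [Algebra (ZMod 2) K] (F : K → K) :
    walsh F 0 0 = Fintype.card K := by
  simp [walsh]

theorem not_isBent_zero {K : Type*} [Field K] [Fintype K] [Algebra (ZMod 2) K] {m : ℕ}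
    (hm : 0 < m) (hcard : Fintype.card K = 2 ^ (2 * m)) (F : K → K) : ¬ IsBent m F 0 := by
  intro h
  have hlt : (2 : ℤ) ^ m < 2 ^ (2 * m) := pow_lt_pow_right₀ (by norm_num) (by omega)
  have hpos : (0 : ℤ) < 2 ^ m := by positivity
  have h0 := h 0
  rw [walsh_zero_zero, hcard] at h0
  push_cast at h0
  omega

/-- Nyberg's bound: a subspace all of whose nonzero elements give bent components has
dimension at most `m`. -/
theorem card_le_of_isBent {K : Type*} [Field K] [Fintype K] [Algebra (ZMod 2) K] {m : ℕ}
    (hm : 0 < m) (hcard : Fintype.card K = 2 ^ (2 * m)) (F : K → K)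
    (V : Submodule (ZMod 2) K) (hV : ∀ v ∈ V, v ≠ 0 → IsBent m F v) :
    Nat.card V ≤ 2 ^ m := by
  classical
  by_contra! hlt
  have hpow : Nat.card V = 2 ^ Module.finrank (ZMod 2) V := by
    simpa using Module.natCard_eq_pow_finrank (K := ZMod 2) (V := V)
  rw [hpow, Nat.pow_lt_pow_iff_right (by norm_num)] at hlt
  have hdvd : (2 : ℤ) ^ (m + 1) ∣ (Fintype.card V : ℤ) := by
    rw [← Nat.card_eq_fintype_card, hpow]
    push_cast
    exact pow_dvd_pow 2 hlt
  have hterm : (2 : ℤ) ^ (m + 1) ∣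
      ∑ v : V, (walsh F v 0 - 2 ^ m + if v = 0 then 2 ^ m else 0) := by
    refine Finset.dvd_sum fun v _ => ?_
    by_cases hv : v = 0
    · subst hv
      simp only [ZeroMemClass.coe_zero, walsh_zero_zero, hcard, if_true, sub_add_cancel]
      push_cast
      exact pow_dvd_pow 2 (by omega)
    · rcases hV v v.2 (by simpa using hv) 0 with h | h
      · simp [h, hv]
      · rw [h, if_neg hv]
        exact ⟨-1, by ring⟩
  rw [Finset.sum_add_distrib, Finset.sum_sub_distrib] at hterm
  simp only [Finset.sum_const, Finset.card_univ, nsmul_eq_mul, Finset.sum_ite_eq',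
    Finset.mem_univ, if_true] at hterm
  have hhalf := (Int.dvd_add_right (dvd_sub (hdvd.trans (card_dvd_sum_walsh F V))
    (hdvd.mul_right (2 ^ m)))).1 hterm
  have hle := Int.le_of_dvd (by positivity) hhalf
  have hpos : (0 : ℤ) < 2 ^ m := by positivity
  rw [pow_succ] at hle
  omega

/-- The equality case of the Bose–Burton theorem over `𝔽₂`: a set `S ∋ 0` with
`#S * N ≤ #K` that meets every subspace of order exceeding `N` in a nonzero element is
closed under addition. -/
theorem add_mem_of_blocking {K : Type*} [AddCommGroup K] [Module (ZMod 2) K] [Finite K]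
    {S : Set K} {N : ℕ} (h0 : (0 : K) ∈ S) (hS : S.ncard * N ≤ Nat.card K)
    (hblock : ∀ V : Submodule (ZMod 2) K, (∀ v ∈ V, v ≠ 0 → v ∉ S) → Nat.card V ≤ N)
    {a b : K} (ha : a ∈ S) (hb : b ∈ S) : a + b ∈ S := by
  by_contra hab
  have hself : ∀ x : K, x + x = 0 := fun x => by
    rw [← two_smul (ZMod 2) x, show (2 : ZMod 2) = 0 from rfl, zero_smul]
  have hsmul : ∀ c : ZMod 2, c = 0 ∨ c = 1 := by decide
  obtain ⟨V, ⟨habV, hV⟩, hmax⟩ := (Set.toFinite {V : Submodule (ZMod 2) K |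
    a + b ∈ V ∧ ∀ v ∈ V, v ≠ 0 → v ∉ S}).exists_maximal ⟨Submodule.span (ZMod 2) {a + b},
      Submodule.mem_span_singleton_self _, fun v hv hv0 => by
        obtain ⟨c, rfl⟩ := Submodule.mem_span_singleton.1 hv
        rcases hsmul c with rfl | rfl
        · simp at hv0
        · simpa using hab⟩
  have hsurj : Function.Surjective fun p : S × V => (p.1 : K) + p.2 := by
    intro x
    by_contra! hx
    have hxS : ∀ v ∈ V, v + x ∉ S := fun v hv hvx => hx (⟨v + x, hvx⟩, ⟨v, hv⟩) (by
      change v + x + v = x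
      rw [add_right_comm, hself, zero_add])
    have hle : V ⊔ Submodule.span (ZMod 2) {x} ≤ V := by
      refine hmax ⟨Submodule.mem_sup_left habV, fun v hv hv0 => ?_⟩ le_sup_left
      obtain ⟨y, hy, z, hz, rfl⟩ := Submodule.mem_sup.1 hv
      obtain ⟨c, rfl⟩ := Submodule.mem_span_singleton.1 hz
      rcases hsmul c with rfl | rfl
      · simp only [zero_smul, add_zero] at hv0 ⊢
        exact hV y hy hv0
      · simpa using hxS y hy
    have hxV : x ∈ V := hle (Submodule.mem_sup_right (Submodule.mem_span_singleton_self x))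
    exact hx (⟨0, h0⟩, ⟨x, hxV⟩) (zero_add x)
  have hcard : Nat.card (S × V) ≤ Nat.card K := by
    rw [Nat.card_prod, Nat.card_coe_set_eq]
    exact (Nat.mul_le_mul_left _ (hblock V hV)).trans hS
  have hbij := hsurj.bijective_of_nat_card_le hcard
  have heq := @hbij.1 (⟨a, ha⟩, 0) (⟨b, hb⟩, ⟨a + b, habV⟩) (by
    change a + 0 = b + (a + b)
    rw [add_left_comm, hself])
  have hzero : a + b = 0 := (congrArg (fun p : S × V => (p.2 : K)) heq).symm
  exact hab (hzero ▸ h0)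

/-- Let `F : F_{2^n} → F_{2^n}` commute with the Frobenius.  If `γ ∈ S_F` then `γ² ∈ S_F`;
consequently, if `#S_F = 2^m` then for every `γ ∈ S_F` the `F₂`-span of the Frobenius orbit of
`γ` is contained in `S_F`. -/
theorem stmt7 (m n : ℕ) (hm : 0 < m) (hn : n = 2 * m)
    (K : Type*) [Field K] [Fintype K] [Algebra (ZMod 2) K]
    (hcard : Fintype.card K = 2 ^ n)
    (F : K → K) (hcomm : ∀ x, F (x ^ 2) = (F x) ^ 2) :
    (∀ γ : K, ¬ IsBent m F γ → ¬ IsBent m F (γ ^ 2)) ∧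
    (Set.ncard {a : K | ¬ IsBent m F a} = 2 ^ m →
      ∀ γ : K, ¬ IsBent m F γ →
        (frobSpan K γ : Set K) ⊆ {a : K | ¬ IsBent m F a}) := by
  subst hn
  have hsq : ∀ γ : K, ¬ IsBent m F γ → ¬ IsBent m F (γ ^ 2) :=
    fun γ h h' => h (isBent_of_isBent_sq hcomm h')
  refine ⟨hsq, fun hS γ hγ x hx => ?_⟩
  have h0 : ¬ IsBent m F (0 : K) := not_isBent_zero hm hcard F
  induction hx using Submodule.span_induction with
  | mem x hx =>
    obtain ⟨i, rfl⟩ := hx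
    change ¬ IsBent m F (γ ^ 2 ^ i)
    induction i with
    | zero => rwa [pow_zero, pow_one]
    | succ i ih =>
      rw [pow_succ, pow_mul]
      exact hsq _ ih
  | zero => exact h0
  | add x y _ _ hx hy =>
    refine add_mem_of_blocking (N := 2 ^ m) h0 ?_ (fun V hV => ?_) hx hy
    · rw [hS, Nat.card_eq_fintype_card, hcard, ← pow_add, two_mul]
    · exact card_le_of_isBent hm hcard F V fun v hv hv0 => not_not.1 (hV v hv hv0)
  | smul c x _ hx =>
    rcases (by decide : ∀ c : ZMod 2, c = 0 ∨ c = 1) c with rfl | rfl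
    · simpa using h0
    · simpa using hx
end

section
/- Let p be an odd prime such that 2 is a primitive root modulo p, and let n = 2p. Then ℓ(n) > p; that is, for every γ ∈ F_{2^n} with F_2(γ) = F_{2^n}, the F_2-dimension of the span of {γ, γ^2, γ^4, …, γ^{2^{n−1}}} is at least p + 1. -/
open Finset

open Polynomial

theorem irreducible_cyclotomic_zmod_two {p : ℕ} (hp : p.Prime) (hodd : p ≠ 2)
    (hroot : orderOf (2 : ZMod p) = p - 1) : Irreducible (cyclotomic p (ZMod 2)) := by
  have h2p : ¬ 2 ∣ p := fun h => hodd ((Nat.prime_dvd_prime_iff_eq Nat.prime_two hp).1 h).symm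
  refine ZMod.irreducible_of_dvd_cyclotomic_of_natDegree h2p dvd_rfl ?_
  rw [natDegree_cyclotomic, Nat.totient_prime hp, ← hroot, ← orderOf_units,
    ZMod.coe_unitOfCoprime, Nat.cast_ofNat]

theorem X_pow_two_mul_sub_one_zmod_two (k : ℕ) :
    (X ^ (2 * k) - 1 : (ZMod 2)[X]) = (X ^ k - 1) ^ 2 := by
  rw [sub_pow_char, one_pow, ← pow_mul, mul_comm]

theorem dvd_X_pow_sub_one_of_natDegree_le {p : ℕ} (hp : p.Prime) (hodd : p ≠ 2)
    (hroot : orderOf (2 : ZMod p) = p - 1) {m : (ZMod 2)[X]}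
    (hdvd : m ∣ X ^ (2 * p) - 1) (hdeg : m.natDegree ≤ p) :
    m ∣ X ^ 2 - 1 ∨ m ∣ X ^ p - 1 := by
  have : Fact p.Prime := ⟨hp⟩
  have hirr := irreducible_cyclotomic_zmod_two hp hodd hroot
  have hfac : cyclotomic p (ZMod 2) * (X - 1) = X ^ p - 1 := cyclotomic_prime_mul_X_sub_one _ p
  have hcdeg : (cyclotomic p (ZMod 2)).natDegree = p - 1 := by
    rw [natDegree_cyclotomic, Nat.totient_prime hp]
  have hp3 : 2 < p := lt_of_le_of_ne hp.two_le hodd.symm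
  rw [X_pow_two_mul_sub_one_zmod_two, ← hfac, mul_pow] at hdvd
  by_cases hc : cyclotomic p (ZMod 2) ∣ m
  · right
    rw [← hfac]
    obtain ⟨k, rfl⟩ := hc
    apply mul_dvd_mul_left
    have hc0 := hirr.ne_zero
    rw [pow_two, mul_assoc, mul_dvd_mul_iff_left hc0] at hdvd
    have hk0 : k ≠ 0 := by
      rintro rfl
      refine mul_ne_zero hc0 (pow_ne_zero 2 (X_sub_C_ne_zero (1 : ZMod 2))) ?_
      simpa using hdvd
    rw [natDegree_mul hc0 hk0, hcdeg] at hdeg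
    obtain h0 | h1 : k.natDegree = 0 ∨ k.natDegree = 1 := by omega
    · exact (isUnit_iff_degree_eq_zero.2 (by rw [degree_eq_natDegree hk0, h0]; rfl)).dvd
    · have hk : Irreducible k :=
        irreducible_of_degree_eq_one (by rw [degree_eq_natDegree hk0, h1]; rfl)
      rcases hk.prime.dvd_or_dvd hdvd with h | h
      · have := natDegree_eq_of_degree_eq
          (degree_eq_degree_of_associated (hk.associated_of_dvd hirr h))
        omega
      · exact hk.prime.dvd_of_dvd_pow h
  · left
    have hcop : IsCoprime m (cyclotomic p (ZMod 2) ^ 2) :=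
      ((hirr.coprime_iff_not_dvd).2 hc).symm.pow_right
    have := X_pow_two_mul_sub_one_zmod_two 1
    rw [mul_one, pow_one] at this
    rw [this]
    exact hcop.dvd_of_dvd_mul_left hdvd

theorem orderOf_frobeniusAlgHom_dvd_of_pow_apply_eq {K : Type*} [Field K] [Algebra (ZMod 2) K]
    {γ : K} (hγ : Subfield.closure {γ} = ⊤) {e : ℕ}
    (h : (FiniteField.frobeniusAlgHom (ZMod 2) K ^ e) γ = γ) :
    orderOf (FiniteField.frobeniusAlgHom (ZMod 2) K) ∣ e := by
  refine orderOf_dvd_of_pow_eq_one (AlgHom.coe_ringHom_injective ?_)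
  apply RingHom.eq_of_eqOn_of_field_closure_eq_top hγ
  rintro x rfl
  exact h

theorem mem_frobSpan_self {K : Type*} [Field K] [Algebra (ZMod 2) K] (γ : K) :
    γ ∈ frobSpan K γ :=
  Submodule.subset_span ⟨0, by simp⟩

theorem frobenius_mem_frobSpan {K : Type*} [Field K] [Algebra (ZMod 2) K] (γ : K) :
    ∀ x ∈ frobSpan K γ,
      (FiniteField.frobeniusAlgHom (ZMod 2) K).toLinearMap x ∈ frobSpan K γ := by
  intro x hx
  suffices frobSpan K γ ≤
      (frobSpan K γ).comap (FiniteField.frobeniusAlgHom (ZMod 2) K).toLinearMap from this hx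
  refine Submodule.span_le.2 ?_
  rintro _ ⟨i, rfl⟩
  refine Submodule.subset_span ⟨i + 1, ?_⟩
  simp [pow_succ, pow_mul]

/-- Let `p` be an odd prime such that `2` is a primitive root modulo `p`, and `n = 2p`.  Then
`ℓ(n) > p`: every `γ` generating `F_{2^n}` over `F₂` has Frobenius-orbit span of
`F₂`-dimension at least `p + 1`. -/
theorem stmt9 (p : ℕ) (hp : p.Prime) (hodd : p ≠ 2)
    (hroot : orderOf (2 : ZMod p) = p - 1)
    (n : ℕ) (hn : n = 2 * p)
    (K : Type*) [Field K] [Fintype K] [Algebra (ZMod 2) K]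
    (hcard : Fintype.card K = 2 ^ n) :
    ∀ γ : K, Subfield.closure {γ} = ⊤ →
      p + 1 ≤ Module.finrank (ZMod 2) (frobSpan K γ) := by
  intro γ hγ
  subst hn
  by_contra! hlt
  have hord : orderOf (FiniteField.frobeniusAlgHom (ZMod 2) K) = 2 * p := by
    rw [FiniteField.orderOf_frobeniusAlgHom]
    have := Module.card_eq_pow_finrank (K := ZMod 2) (V := K)
    rw [hcard, ZMod.card] at this
    exact (Nat.pow_right_injective le_rfl this).symm
  set ρ : Module.End (ZMod 2) (frobSpan K γ) :=
    (FiniteField.frobeniusAlgHom (ZMod 2) K).toLinearMap.restrict (frobenius_mem_frobSpan γ)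
  have hpow (e : ℕ) (x : frobSpan K γ) :
      ((ρ ^ e) x : K) = (FiniteField.frobeniusAlgHom (ZMod 2) K ^ e) x := by
    induction e with
    | zero => simp
    | succ e ih => rw [pow_succ', pow_succ', Module.End.mul_apply, AlgHom.mul_apply, ← ih]; rfl
  have hdvd : minpoly (ZMod 2) ρ ∣ X ^ (2 * p) - 1 := by
    refine minpoly.dvd _ _ (LinearMap.ext fun x => Subtype.ext ?_)
    simp [hpow, ← hord, pow_orderOf_eq_one]
  have hdeg : (minpoly (ZMod 2) ρ).natDegree ≤ p := by
    have := natDegree_le_of_dvd ρ.minpoly_dvd_charpoly ρ.charpoly_monic.ne_zero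
    rw [LinearMap.charpoly_natDegree] at this
    omega
  have hfix (e : ℕ) (h : minpoly (ZMod 2) ρ ∣ X ^ e - 1) : 2 * p ∣ e := by
    rw [← hord]
    refine orderOf_frobeniusAlgHom_dvd_of_pow_apply_eq hγ ?_
    have h0 := (minpoly.dvd_iff (A := ZMod 2)).1 h
    have h1 := congrArg Subtype.val (LinearMap.congr_fun h0 ⟨γ, mem_frobSpan_self γ⟩)
    simpa [hpow, sub_eq_zero] using h1
  have hp2 := hp.two_le
  rcases dvd_X_pow_sub_one_of_natDegree_le hp hodd hroot hdvd hdeg with h | h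
  · have := Nat.le_of_dvd two_pos (hfix 2 h)
    omega
  · have := Nat.le_of_dvd hp.pos (hfix p h)
    omega
end

section
/- Let n = 2^k for a positive integer k. Then ℓ(n) > 2^{k−1}; that is, for every γ ∈ F_{2^n} with F_2(γ) = F_{2^n}, the F_2-dimension of the span of {γ, γ^2, γ^4, …, γ^{2^{n−1}}} is at least 2^{k−1} + 1. -/
open Finset

/-- Over `F₂`, `(f - 1)^(2^j) = f^(2^j) - 1` for every endomorphism `f`. -/
theorem Module.End.sub_one_pow_two_pow {V : Type*} [AddCommGroup V] [Module (ZMod 2) V]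
    (f : Module.End (ZMod 2) V) (j : ℕ) : (f - 1) ^ 2 ^ j = f ^ 2 ^ j - 1 := by
  have h : (Polynomial.X - 1 : Polynomial (ZMod 2)) ^ 2 ^ j = Polynomial.X ^ 2 ^ j - 1 := by
    rw [sub_pow_char_pow, one_pow]
  simpa using congrArg (Polynomial.aeval f) h

/-- If `g` maps a finite-dimensional subspace `W` of dimension at most `m` to itself and is
nilpotent, then `g ^ m` vanishes on `W`. -/
theorem Module.End.pow_apply_eq_zero_of_finrank_le {F V : Type*} [Field F] [AddCommGroup V]
    [Module F V] (g : Module.End F V) (W : Submodule F V) [FiniteDimensional F W]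
    (hW : ∀ x ∈ W, g x ∈ W) (hg : IsNilpotent g) {m : ℕ} (hm : Module.finrank F W ≤ m)
    {x : V} (hx : x ∈ W) : (g ^ m) x = 0 := by
  obtain ⟨N, hN⟩ := hg
  have h₀ : (g.restrict hW) ^ (N + m) = 0 := by
    ext y
    simp [Module.End.pow_restrict, pow_add, hN]
  have hker : LinearMap.ker ((g.restrict hW) ^ m) = ⊤ := by
    rw [Module.End.ker_pow_eq_ker_pow_finrank_of_le hm,
      ← Module.End.ker_pow_eq_ker_pow_finrank_of_le (hm.trans (Nat.le_add_left m N)), h₀,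
      LinearMap.ker_zero]
  have h₁ : ((g.restrict hW) ^ m) ⟨x, hx⟩ = 0 := by
    rw [← LinearMap.mem_ker, hker]; trivial
  rw [Module.End.pow_restrict] at h₁
  simpa using congrArg Subtype.val h₁

/-- A finite field of characteristic two generated by an element fixed by the `m`-th power of
Frobenius has at most `2 ^ m` elements. -/
theorem card_le_two_pow_of_closure_eq_top {K : Type*} [Field K] [Fintype K] [CharP K 2] {γ : K}
    (hγ : Subfield.closure {γ} = ⊤) {m : ℕ} (hm : 0 < m) (h : γ ^ 2 ^ m = γ) :
    Fintype.card K ≤ 2 ^ m := by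
  have hle : Subfield.closure {γ} ≤ (iterateFrobenius K 2 m).eqLocusField (RingHom.id K) := by
    rw [Subfield.closure_le, Set.singleton_subset_iff]
    simpa [iterateFrobenius_def] using h
  have hfix : ∀ x : K, x ^ 2 ^ m = x := fun x => by
    have : x ∈ Subfield.closure {γ} := hγ ▸ Subfield.mem_top x
    simpa [iterateFrobenius_def] using hle this
  have h1 : 1 < 2 ^ m := Nat.one_lt_two_pow hm.ne'
  have hne := FiniteField.X_pow_card_sub_X_ne_zero K h1
  have hsub : (Finset.univ : Finset K).val ≤
      (Polynomial.X ^ 2 ^ m - Polynomial.X : Polynomial K).roots := by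
    refine (Multiset.le_iff_subset Finset.univ.nodup).2 fun x _ => ?_
    rw [Polynomial.mem_roots hne]
    simp [hfix x]
  calc Fintype.card K ≤ _ := Multiset.card_le_card hsub
    _ ≤ _ := Polynomial.card_roots' _
    _ = 2 ^ m := FiniteField.X_pow_card_sub_X_natDegree_eq K h1

/-- Let `n = 2^k` for a positive integer `k`.  Then `ℓ(n) > 2^{k−1}`: every `γ` generating
`F_{2^n}` over `F₂` has Frobenius-orbit span of `F₂`-dimension at least `2^{k−1} + 1`. -/
theorem stmt10 (k : ℕ) (hk : 0 < k) (n : ℕ) (hn : n = 2 ^ k)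
    (K : Type*) [Field K] [Fintype K] [Algebra (ZMod 2) K]
    (hcard : Fintype.card K = 2 ^ n) :
    ∀ γ : K, Subfield.closure {γ} = ⊤ →
      2 ^ (k - 1) + 1 ≤ Module.finrank (ZMod 2) (frobSpan K γ) := by
  intro γ hγ
  by_contra! hlt
  have : CharP K 2 := charP_of_injective_algebraMap' (ZMod 2) 2
  let f : Module.End (ZMod 2) K := (FiniteField.frobeniusAlgHom (ZMod 2) K).toLinearMap
  have hf : ∀ (j : ℕ) (x : K), (f ^ j) x = x ^ 2 ^ j := fun j x => by
    induction j with
    | zero => simp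
    | succ j ih =>
      rw [pow_succ', Module.End.mul_apply, ih]
      simp [f, ZMod.card, pow_succ, pow_mul]
  have hnil : IsNilpotent (f - 1) := by
    refine ⟨2 ^ k, ?_⟩
    rw [Module.End.sub_one_pow_two_pow, sub_eq_zero]
    ext x
    rw [hf, ← hn, ← hcard, FiniteField.pow_card, Module.End.one_apply]
  have hinv : ∀ x ∈ frobSpan K γ, (f - 1) x ∈ frobSpan K γ := fun x hx => by
    refine Submodule.sub_mem _ ?_ hx
    refine (Submodule.span_le (p := (frobSpan K γ).comap f)).2 ?_ hx
    rintro _ ⟨i, rfl⟩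
    refine Submodule.subset_span ⟨i + 1, ?_⟩
    simp [f, ZMod.card, pow_succ, pow_mul]
  have hmem : γ ∈ frobSpan K γ := Submodule.subset_span ⟨0, by simp⟩
  have h0 := Module.End.pow_apply_eq_zero_of_finrank_le (f - 1) _ hinv hnil
    (Nat.lt_succ_iff.1 hlt) hmem
  rw [Module.End.sub_one_pow_two_pow, LinearMap.sub_apply, hf, Module.End.one_apply,
    sub_eq_zero] at h0
  have hle := card_le_two_pow_of_closure_eq_top hγ (by positivity) h0
  rw [hcard, hn, Nat.pow_le_pow_iff_right one_lt_two, Nat.pow_le_pow_iff_right one_lt_two] at hle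
  omega
end
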